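/- Let f : ℝ → ℂ be an even Schwartz function and F(y) = ∫_ℝ f(x) cos(2πxy) dx. Then for all s ∈ ℂ with 0 < Re s < 1, ∫_0^∞ F(t) t^{s−1} dt = [π^{−s/2} Γ(s/2) / (π^{(s−1)/2} Γ((1−s)/2))] · ∫_0^∞ f(t) t^{−s} dt. -/

import Mathlib

open Real Complex MeasureTheory Set

section Helpers

open scoped FourierTransform Topology
open Filter Asymptotics

lemma aux_gamma {x : ℝ} (hx : 0 < x) {a : ℂ} (ha : 0 < a.re) :
    ∫ b in Ioi (0:ℝ), (b:ℂ) ^ (a - 1) * cexp (-π * b * x ^ 2)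
      = (π:ℂ) ^ (-a) * Complex.Gamma a * (x:ℂ) ^ (-2 * a) := by
  have hr : 0 < π * x ^ 2 := by positivity
  have h := Complex.integral_cpow_mul_exp_neg_mul_Ioi ha hr
  have e : (1 / ((π * x ^ 2 : ℝ) : ℂ)) ^ a = (π:ℂ) ^ (-a) * (x:ℂ) ^ (-2 * a) := by
    rw [one_div, inv_cpow _ _ (by rw [arg_ofReal_of_nonneg hr.le]; exact pi_pos.ne),
      ← cpow_neg, ofReal_mul, mul_cpow_ofReal_nonneg pi_pos.le (by positivity)]
    congr 1
    rw [pow_two, ofReal_mul, mul_cpow_ofReal_nonneg hx.le hx.le,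
      ← cpow_add _ _ (ofReal_ne_zero.2 hx.ne')]
    congr 1; ring
  rw [e] at h
  rw [mul_right_comm, ← h]
  refine integral_congr_ae (Eventually.of_forall fun b => ?_)
  simp only
  congr 2
  push_cast; ring

lemma aux_norm {x b : ℝ} (hb : 0 < b) (a z : ℂ) :
    ‖(b:ℂ) ^ (a - 1) * (z * cexp (-π * b * x ^ 2))‖
      = ‖z‖ * (b ^ (a.re - 1) * Real.exp (-(π * x ^ 2 * b))) := by
  rw [norm_mul, norm_mul, norm_cpow_eq_rpow_re_of_pos hb, Complex.norm_exp]
  have : (-π * b * x ^ 2 : ℂ).re = -(π * x ^ 2 * b) := by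
    rw [show (-π * b * x ^ 2 : ℂ) = ((-(π * x ^ 2 * b) : ℝ) : ℂ) by push_cast; ring, ofReal_re]
  rw [this, sub_re, one_re]; ring

lemma aux_mellin (g : ℝ → ℂ) (hg : Continuous g) {a : ℂ} (ha : 0 < a.re)
    (hm : MellinConvergent g (1 - 2 * a)) :
    mellin (fun b : ℝ => ∫ x in Ioi (0:ℝ), g x * cexp (-π * b * x ^ 2)) a
      = (π:ℂ) ^ (-a) * Complex.Gamma a * mellin g (1 - 2 * a) := by
  unfold mellin
  simp only [smul_eq_mul, ← integral_const_mul]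
  rw [integral_integral_swap]
  · refine setIntegral_congr_fun measurableSet_Ioi fun x hx => ?_
    have := aux_gamma hx ha
    rw [show (1 - 2 * a - 1) = -2 * a by ring, ← mul_assoc, ← this, mul_comm, ← integral_const_mul]
    refine integral_congr_ae (Eventually.of_forall fun b => ?_)
    simp only; ring
  · have hmeas : AEStronglyMeasurable (Function.uncurry fun (b x : ℝ) =>
        (b:ℂ) ^ (a - 1) * (g x * cexp (-π * b * x ^ 2)))
        ((volume.restrict (Ioi 0)).prod (volume.restrict (Ioi (0:ℝ)))) := by
      apply Measurable.aestronglyMeasurable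
      have := hg.measurable
      unfold Function.uncurry
      fun_prop
    rw [integrable_prod_iff' hmeas]
    constructor
    · filter_upwards [ae_restrict_mem measurableSet_Ioi] with x hx
      have hr : 0 < π * x ^ 2 := by have : 0 < x := hx; positivity
      have h1 := (integrableOn_rpow_mul_exp_neg_mul_rpow (s := a.re - 1) (p := 1)
        (by linarith) one_pos hr).const_mul ‖g x‖
      refine Integrable.mono' h1 ?_ ?_
      · apply Measurable.aestronglyMeasurable
        unfold Function.uncurry
        fun_prop
      · filter_upwards [ae_restrict_mem measurableSet_Ioi] with b hb
        simp only [Function.uncurry]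
        rw [aux_norm hb, rpow_one, neg_mul]
    · have h2 := hm.norm.const_mul ((1 / π) ^ a.re * Real.Gamma a.re)
      refine h2.congr ?_
      filter_upwards [ae_restrict_mem measurableSet_Ioi] with x hx
      have hx : 0 < x := hx
      have hr : 0 < π * x ^ 2 := by positivity
      have e : ∫ b in Ioi (0:ℝ), ‖(Function.uncurry fun (b x : ℝ) =>
        (b:ℂ) ^ (a - 1) * (g x * cexp (-π * b * x ^ 2))) (b, x)‖
          = ∫ b in Ioi (0:ℝ), ‖g x‖ * (b ^ (a.re - 1) * Real.exp (-(π * x ^ 2 * b))) :=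
        setIntegral_congr_fun measurableSet_Ioi fun b hb => aux_norm hb _ _
      rw [e, integral_const_mul, Real.integral_rpow_mul_exp_neg_mul_Ioi ha hr, norm_smul,
        norm_cpow_eq_rpow_re_of_pos hx]
      have : (1 - 2 * a - 1).re = -2 * a.re := by simp
      rw [this, one_div, one_div, mul_inv, mul_rpow (by positivity) (by positivity),
        neg_mul, rpow_neg hx.le, rpow_mul hx.le, inv_rpow (sq_nonneg x)]
      norm_num
      ring

lemma aux_conv (g : SchwartzMap ℝ ℂ) {s : ℂ} (hs : 0 < s.re) : MellinConvergent g s := by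
  refine mellinConvergent_of_isBigO_rpow (a := s.re + 1) (b := 0)
    (g.continuous.locallyIntegrable.locallyIntegrableOn _) ?_ (by linarith) ?_ hs
  · have h := (g.isBigO_cocompact_rpow (-(s.re + 1))).mono atTop_le_cocompact
    refine h.trans (EventuallyEq.isBigO ?_)
    filter_upwards [eventually_gt_atTop 0] with x hx
    rw [Real.norm_of_nonneg hx.le]
  · simp only [neg_zero, rpow_zero]
    exact (g.continuous.continuousAt.mono_left nhdsWithin_le_nhds).isBigO_one ℝ

lemma aux_even (h : ℝ → ℂ) (hi : Integrable h) (he : ∀ x, h (-x) = h x) :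
    ∫ x, h x = 2 * ∫ x in Ioi (0:ℝ), h x := by
  rw [← integral_add_compl (measurableSet_Ioi (a := (0:ℝ))) hi, compl_Ioi, two_mul]
  congr 1
  have := integral_comp_neg_Iic (0:ℝ) h
  simpa [he] using this

lemma aux_cos (f : SchwartzMap ℝ ℂ) (hf : ∀ x : ℝ, f (-x) = f x) (y : ℝ) :
    (𝓕 f : SchwartzMap ℝ ℂ) y = ∫ x : ℝ, f x * Real.cos (2 * π * x * y) := by
  have h1 : (𝓕 f : SchwartzMap ℝ ℂ) y = ∫ x : ℝ, cexp (↑(-2 * π * x * y) * I) * f x := by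
    rw [SchwartzMap.fourier_coe, fourier_real_eq_integral_exp_smul]; rfl
  have h2 : (𝓕 f : SchwartzMap ℝ ℂ) y = ∫ x : ℝ, cexp (↑(2 * π * x * y) * I) * f x := by
    rw [h1, ← integral_neg_eq_self]
    refine integral_congr_ae (Eventually.of_forall fun x => ?_)
    simp only [hf]
    congr 3
    push_cast; ring
  have hint : ∀ c : ℝ, Integrable fun x : ℝ => cexp (↑(c * x * y) * I) * f x := by
    intro c
    refine f.integrable.norm.mono' ?_ ?_
    · have := f.continuous
      exact Continuous.aestronglyMeasurable (by fun_prop)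
    · refine Eventually.of_forall fun x => ?_
      rw [norm_mul, norm_exp_ofReal_mul_I, one_mul]
  have h3 : 2 * (𝓕 f : SchwartzMap ℝ ℂ) y = 2 * ∫ x : ℝ, f x * Real.cos (2 * π * x * y) := by
    rw [two_mul]
    nth_rewrite 1 [h1]
    rw [h2, ← integral_add (hint _) (hint _), ← integral_const_mul]
    refine integral_congr_ae (Eventually.of_forall fun x => ?_)
    simp only [ofReal_cos, Complex.cos]
    push_cast
    ring_nf
  exact mul_left_cancel₀ two_ne_zero h3

lemma aux_gauss_int {b : ℝ} (hb : 0 < b) :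
    Integrable fun x : ℝ => cexp (-π * b * x ^ 2) := by
  have := integrable_cexp_neg_mul_sq (b := (π * b : ℂ))
    (by rw [← ofReal_mul, ofReal_re]; positivity)
  simpa [neg_mul] using this

lemma aux_parseval (f : SchwartzMap ℝ ℂ) {b : ℝ} (hb : 0 < b) :
    ∫ x, (𝓕 f : SchwartzMap ℝ ℂ) x * cexp (-π * b * x ^ 2)
      = (b:ℂ) ^ (-(1/2) : ℂ) * ∫ x, f x * cexp (-π * ((b⁻¹ : ℝ) : ℂ) * x ^ 2) := by
  have h : ∫ x, (𝓕 f : SchwartzMap ℝ ℂ) x * cexp (-π * b * x ^ 2)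
      = ∫ x, f x * (𝓕 fun x : ℝ => cexp (-π * b * x ^ 2)) x := by
    simpa using! VectorFourier.integral_bilin_fourierIntegral_eq_flip (.mul ℂ ℂ) (L := innerₗ ℝ)
      continuous_fourierChar continuous_inner f.integrable (aux_gauss_int hb)
  rw [h, fourier_gaussian_pi (by simpa using hb), ← integral_const_mul]
  refine integral_congr_ae (Eventually.of_forall fun x => ?_)
  simp only [cpow_neg, one_div, ofReal_inv, div_eq_mul_inv]
  ring

lemma aux_gauss_mul_int (f : SchwartzMap ℝ ℂ) {b : ℝ} (hb : 0 < b) :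
    Integrable fun x : ℝ => f x * cexp (-π * b * x ^ 2) := by
  refine f.integrable.norm.mono' ?_ ?_
  · have := f.continuous
    exact Continuous.aestronglyMeasurable (by fun_prop)
  · refine Eventually.of_forall fun x => ?_
    rw [norm_mul, Complex.norm_exp,
      show (-π * b * x ^ 2 : ℂ) = ((-(π * x ^ 2 * b) : ℝ) : ℂ) by push_cast; ring, ofReal_re]
    refine mul_le_of_le_one_right (norm_nonneg _) (Real.exp_le_one_iff.2 ?_)
    have : 0 ≤ π * x ^ 2 * b := by positivity
    linarith

lemma aux_half (f : SchwartzMap ℝ ℂ) (hf : ∀ x : ℝ, f (-x) = f x) {b : ℝ} (hb : 0 < b) :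
    ∫ x in Ioi (0:ℝ), (𝓕 f : SchwartzMap ℝ ℂ) x * cexp (-π * b * x ^ 2)
      = (b:ℂ) ^ (-(1/2) : ℂ) *
        ∫ x in Ioi (0:ℝ), f x * cexp (-π * ((b⁻¹ : ℝ) : ℂ) * x ^ 2) := by
  have h := aux_parseval f hb
  rw [aux_even _ (aux_gauss_mul_int _ hb), aux_even _ (aux_gauss_mul_int f (inv_pos.2 hb))] at h
  · refine mul_left_cancel₀ (two_ne_zero (α := ℂ)) ?_
    rw [h]; ring
  · intro x; simp [hf]
  · intro x
    have : (𝓕 f : SchwartzMap ℝ ℂ) (-x) = (𝓕 f : SchwartzMap ℝ ℂ) x := by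
      rw [aux_cos f hf, aux_cos f hf]; simp
    simp [this]

lemma aux_main (f : SchwartzMap ℝ ℂ) (hf : ∀ x : ℝ, f (-x) = f x)
    (s : ℂ) (hs0 : 0 < s.re) (hs1 : s.re < 1) :
    (π:ℂ) ^ ((s - 1) / 2) * Complex.Gamma ((1 - s) / 2) * mellin (𝓕 f : SchwartzMap ℝ ℂ) s
      = (π:ℂ) ^ (-s / 2) * Complex.Gamma (s / 2) * mellin f (1 - s) := by
  have e1 : 1 - 2 * ((1 - s) / 2) = s := by ring
  have e2 : 1 - 2 * (s / 2) = 1 - s := by ring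
  have h1 := aux_mellin (𝓕 f : SchwartzMap ℝ ℂ) (𝓕 f : SchwartzMap ℝ ℂ).continuous
    (a := (1 - s) / 2) (by simp; linarith) (aux_conv _ (by rw [e1]; exact hs0))
  have h2 := aux_mellin f f.continuous
    (a := s / 2) (by simp; linarith) (aux_conv _ (by rw [e2]; simp; linarith))
  rw [e1] at h1
  rw [e2] at h2
  rw [show (s - 1) / 2 = -((1 - s) / 2) by ring, ← h1, neg_div, ← h2]
  have h3 : mellin (fun b : ℝ => ∫ x in Ioi (0:ℝ),
        (𝓕 f : SchwartzMap ℝ ℂ) x * cexp (-π * b * x ^ 2)) ((1 - s) / 2)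
      = mellin (fun b : ℝ => (b:ℂ) ^ (-(1/2) : ℂ) •
        (fun c : ℝ => ∫ x in Ioi (0:ℝ), f x * cexp (-π * c * x ^ 2)) b⁻¹) ((1 - s) / 2) := by
    refine setIntegral_congr_fun measurableSet_Ioi fun b hb => ?_
    simp only
    rw [aux_half f hf hb, smul_eq_mul ((b:ℂ) ^ (-(1/2) : ℂ))]
  rw [h3, mellin_cpow_smul]
  refine (mellin_comp_inv (fun c : ℝ => ∫ x in Ioi (0:ℝ), f x * cexp (-π * c * x ^ 2)) _).trans ?_
  congr 1
  ring

end Helpers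

/-- For an even Schwartz function `f` with Fourier cosine transform
`F(y) = ∫_ℝ f(x) cos(2πxy) dx`, and `0 < Re s < 1`:
`∫_0^∞ F(t) t^{s-1} dt = [π^{-s/2} Γ(s/2) / (π^{(s-1)/2} Γ((1-s)/2))] ∫_0^∞ f(t) t^{-s} dt`. -/
theorem mellin_of_cosine_transform (f : SchwartzMap ℝ ℂ)
    (hf : ∀ x : ℝ, f (-x) = f x)
    (F : ℝ → ℂ) (hF : ∀ y : ℝ, F y = ∫ x : ℝ, f x * Real.cos (2 * π * x * y))
    (s : ℂ) (hs0 : 0 < s.re) (hs1 : s.re < 1) :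
    ∫ t in Ioi (0 : ℝ), F t * (t : ℂ) ^ (s - 1)
      = ((Real.pi : ℂ) ^ (-s / 2) * Complex.Gamma (s / 2)
          / ((Real.pi : ℂ) ^ ((s - 1) / 2) * Complex.Gamma ((1 - s) / 2)))
        * ∫ t in Ioi (0 : ℝ), f t * (t : ℂ) ^ (-s) := by
  have hFf : ∀ t, F t = (FourierTransform.fourier f : SchwartzMap ℝ ℂ) t := fun t => by
    rw [hF, aux_cos f hf]
  have h := aux_main f hf s hs0 hs1
  have hne : (Real.pi : ℂ) ^ ((s - 1) / 2) * Complex.Gamma ((1 - s) / 2) ≠ 0 := by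
    refine mul_ne_zero ?_ (Complex.Gamma_ne_zero_of_re_pos (by simp; linarith))
    rw [Ne, cpow_eq_zero_iff]
    simp [pi_ne_zero]
  have e1 : ∫ t in Ioi (0 : ℝ), F t * (t : ℂ) ^ (s - 1)
      = mellin (FourierTransform.fourier f : SchwartzMap ℝ ℂ) s := by
    simp only [mellin, hFf, smul_eq_mul, mul_comm]
  have e2 : ∫ t in Ioi (0 : ℝ), f t * (t : ℂ) ^ (-s) = mellin f (1 - s) := by
    simp only [mellin, smul_eq_mul, mul_comm, sub_sub_cancel_left]
  rw [e1, e2, div_mul_eq_mul_div, eq_div_iff hne, ← h]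
  ring
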